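/- arXiv:1905.06865 — 2 statements merged into one kernel-verified Lean document; each statement's English description precedes it below -/
import Mathlib

section
/- Let A_n be positive semidefinite trace class operators on a separable Hilbert space H converging in the weak operator topology to a trace class operator A. Then ‖A_n − A‖₁ → 0 if and only if tr A_n → tr A. -/
noncomputable section

open Filter Topology

local notation "⟪" x ", " y "⟫" => @inner ℂ _ _ x y

/-- The trace norm of a bounded operator on a complex Hilbert space, defined as the
supremum over all pairs of finite orthonormal families of `∑ i, ‖⟪L (x i), y i⟫‖`.
For trace class operators this equals the sum of the singular values, and an operator
is trace class iff this is finite. -/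
def traceNorm {H : Type*} [NormedAddCommGroup H] [InnerProductSpace ℂ H]
    (L : H →L[ℂ] H) : ENNReal :=
  ⨆ (n : ℕ) (x : Fin n → H) (_ : Orthonormal ℂ x) (y : Fin n → H) (_ : Orthonormal ℂ y),
    ∑ i, (‖⟪L (x i), y i⟫‖₊ : ENNReal)

/-- index set of a chosen Hilbert basis of `H` -/
def hIndex (H : Type*) [NormedAddCommGroup H] [InnerProductSpace ℂ H] [CompleteSpace H] :
    Set H :=
  (exists_hilbertBasis ℂ H).choose

/-- a chosen Hilbert basis of `H` -/
def hBasis (H : Type*) [NormedAddCommGroup H] [InnerProductSpace ℂ H] [CompleteSpace H] :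
    HilbertBasis (hIndex H) ℂ H :=
  (exists_hilbertBasis ℂ H).choose_spec.choose

/-- the trace of an operator (meaningful for trace class operators, where it is
independent of the chosen Hilbert basis) -/
def opTrace {H : Type*} [NormedAddCommGroup H] [InnerProductSpace ℂ H] [CompleteSpace H]
    (L : H →L[ℂ] H) : ℂ :=
  ∑' i : hIndex H, ⟪(hBasis H i : H), L (hBasis H i)⟫

namespace TraceAux

variable {H : Type*} [NormedAddCommGroup H] [InnerProductSpace ℂ H] [CompleteSpace H]

theorem sum_le_traceNorm {L : H →L[ℂ] H} (hL : traceNorm L ≠ ⊤) {n : ℕ} {x y : Fin n → H}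
    (hx : Orthonormal ℂ x) (hy : Orthonormal ℂ y) :
    ∑ i, ‖⟪L (x i), y i⟫‖ ≤ (traceNorm L).toReal := by
  have h : ∑ i, (‖⟪L (x i), y i⟫‖₊ : ENNReal) ≤ traceNorm L := by
    unfold traceNorm
    exact le_iSup_of_le n (le_iSup_of_le x (le_iSup_of_le hx (le_iSup_of_le y
      (le_iSup_of_le hy le_rfl))))
  have h2 := ENNReal.toReal_mono hL h
  rw [ENNReal.toReal_sum (by simp)] at h2
  simpa using h2

theorem traceNorm_le {L : H →L[ℂ] H} {c : ℝ}
    (h : ∀ (n : ℕ) (x y : Fin n → H), Orthonormal ℂ x → Orthonormal ℂ y →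
      ∑ i, ‖⟪L (x i), y i⟫‖ ≤ c) : traceNorm L ≤ ENNReal.ofReal c := by
  unfold traceNorm
  refine iSup_le fun n => iSup_le fun x => iSup_le fun hx => iSup_le fun y => iSup_le fun hy => ?_
  refine le_trans (le_of_eq ?_) (ENNReal.ofReal_le_ofReal (h n x y hx hy))
  rw [ENNReal.ofReal_sum_of_nonneg (fun _ _ => norm_nonneg _)]
  refine Finset.sum_congr rfl fun i _ => ?_
  rw [ofReal_norm_eq_enorm]; rfl

theorem fin_sum_le {ι : Type*} (b : HilbertBasis ι ℂ H) {L : H →L[ℂ] H} (hL : traceNorm L ≠ ⊤)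
    (s : Finset ι) : ∑ i ∈ s, ‖⟪b i, L (b i)⟫‖ ≤ (traceNorm L).toReal := by
  have ho : Orthonormal ℂ (fun k : Fin s.card => b (s.equivFin.symm k)) :=
    b.orthonormal.comp _ (Subtype.val_injective.comp s.equivFin.symm.injective)
  have := sum_le_traceNorm hL ho ho
  refine le_trans (le_of_eq ?_) this
  rw [← Finset.sum_coe_sort, ← s.equivFin.symm.sum_comp]
  exact Finset.sum_congr rfl fun i _ => norm_inner_symm _ _

theorem summ {ι : Type*} (b : HilbertBasis ι ℂ H) {L : H →L[ℂ] H} (hL : traceNorm L ≠ ⊤) :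
    Summable (fun i => ⟪b i, L (b i)⟫) :=
  Summable.of_norm (summable_of_sum_le (fun _ => norm_nonneg _) (fin_sum_le b hL))

theorem norm_opTrace_le {L : H →L[ℂ] H} (hL : traceNorm L ≠ ⊤) :
    ‖opTrace L‖ ≤ (traceNorm L).toReal := by
  have hs : Summable (fun i => ‖⟪hBasis H i, L (hBasis H i)⟫‖) :=
    summable_of_sum_le (fun _ => norm_nonneg _) (fin_sum_le _ hL)
  exact (norm_tsum_le_tsum_norm hs).trans (Real.tsum_le_of_sum_le (fun _ => norm_nonneg _)
    (fin_sum_le _ hL))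

theorem exists_root {A : H →L[ℂ] H} (hA : A.IsPositive) :
    ∃ S : H →L[ℂ] H, (∀ x y, ⟪S x, y⟫ = ⟪x, S y⟫) ∧ ∀ x, A x = S (S x) := by
  have h0 : 0 ≤ A := (ContinuousLinearMap.nonneg_iff_isPositive A).2 hA
  have hS : (CFC.sqrt A).IsPositive :=
    (ContinuousLinearMap.nonneg_iff_isPositive _).1 (CFC.sqrt_nonneg A)
  refine ⟨CFC.sqrt A, fun x y => hS.isSymmetric x y, fun x => ?_⟩
  conv_lhs => rw [← CFC.sqrt_mul_sqrt_self A h0]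
  rfl

theorem pos_sum_le {ι : Type*} (b : HilbertBasis ι ℂ H) {A : H →L[ℂ] H} (hA : A.IsPositive)
    {t : ℝ} (ht : HasSum (fun i => (⟪b i, A (b i)⟫).re) t)
    {n : ℕ} {x : Fin n → H} (hx : Orthonormal ℂ x) :
    ∑ k, (⟪x k, A (x k)⟫).re ≤ t := by
  obtain ⟨S, hS, hAS⟩ := exists_root hA
  have key : ∀ v, (⟪v, A v⟫).re = ‖S v‖ ^ 2 := fun v => by
    rw [hAS, ← hS]
    exact inner_self_eq_norm_sq (𝕜 := ℂ) (S v)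
  have h1 : ∀ k, HasSum (fun i => ‖⟪x k, S (b i)⟫‖ ^ 2) (⟪x k, A (x k)⟫).re := fun k => by
    have := Complex.hasSum_re (b.hasSum_inner_mul_inner (S (x k)) (S (x k)))
    rw [hS (x k) (S (x k)), ← hAS] at this
    convert this using 1
    funext i
    rw [hS, ← hS (b i), ← inner_conj_symm (S (b i)), Complex.mul_conj, Complex.normSq_eq_norm_sq,
      Complex.ofReal_re]
  refine hasSum_le (fun i => ?_) (hasSum_sum fun k (_ : k ∈ Finset.univ) => h1 k) ht
  rw [key]
  exact hx.sum_inner_products_le _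

theorem bilin_le {ι : Type*} (b : HilbertBasis ι ℂ H) {A : H →L[ℂ] H} (hA : A.IsPositive)
    (T U : H →L[ℂ] H) {t u : ℝ} (ht : HasSum (fun i => (⟪T (b i), A (T (b i))⟫).re) t)
    (hu : HasSum (fun i => (⟪U (b i), A (U (b i))⟫).re) u)
    {n : ℕ} {x y : Fin n → H} (hx : Orthonormal ℂ x) (hy : Orthonormal ℂ y) :
    ∑ k, ‖⟪A (T (x k)), U (y k)⟫‖ ≤ √t * √u := by
  obtain ⟨S, hS, hAS⟩ := exists_root hA
  have key : ∀ v, (⟪v, A v⟫).re = ‖S v‖ ^ 2 := fun v => by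
    rw [hAS, ← hS]
    exact inner_self_eq_norm_sq (𝕜 := ℂ) (S v)
  have hc : ∀ (T : H →L[ℂ] H) (v : H),
      ⟪v, (ContinuousLinearMap.adjoint T ∘L A ∘L T) v⟫ = ⟪T v, A (T v)⟫ := fun T v => by
    simp [ContinuousLinearMap.adjoint_inner_right]
  have h1 := pos_sum_le b (hA.adjoint_conj T) (t := t) (by simpa only [hc] using ht) hx
  have h2 := pos_sum_le b (hA.adjoint_conj U) (t := u) (by simpa only [hc] using hu) hy
  simp only [hc, key] at h1 h2
  calc ∑ k, ‖⟪A (T (x k)), U (y k)⟫‖ ≤ ∑ k, ‖S (T (x k))‖ * ‖S (U (y k))‖ := by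
        refine Finset.sum_le_sum fun k _ => ?_
        rw [hAS, hS]
        exact norm_inner_le_norm _ _
    _ ≤ √(∑ k, ‖S (T (x k))‖ ^ 2) * √(∑ k, ‖S (U (y k))‖ ^ 2) :=
        Real.sum_mul_le_sqrt_mul_sqrt _ _ _
    _ ≤ √t * √u := by gcongr

/-- finite rank projection -/
def proj {ι : Type*} (b : HilbertBasis ι ℂ H) (F : Finset ι) : H →L[ℂ] H :=
  ∑ i ∈ F, (innerSL ℂ (b i)).smulRight (b i)

theorem proj_apply {ι : Type*} (b : HilbertBasis ι ℂ H) (F : Finset ι) (x : H) :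
    proj b F x = ∑ i ∈ F, ⟪b i, x⟫ • b i := by
  simp [proj, ContinuousLinearMap.sum_apply]

theorem proj_basis {ι : Type*} [DecidableEq ι] (b : HilbertBasis ι ℂ H) (F : Finset ι) (j : ι) :
    proj b F (b j) = if j ∈ F then b j else 0 := by
  rw [proj_apply]
  simp [orthonormal_iff_ite.1 b.orthonormal, ite_smul]

theorem comp_le {ι : Type*} (b : HilbertBasis ι ℂ H) (F : Finset ι) (D : H →L[ℂ] H)
    {n : ℕ} {x y : Fin n → H} (hx : Orthonormal ℂ x) (hy : Orthonormal ℂ y) :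
    ∑ k, ‖⟪D (proj b F (x k)), proj b F (y k)⟫‖ ≤ ∑ i ∈ F, ∑ j ∈ F, ‖⟪D (b i), b j⟫‖ := by
  have hbes : ∀ {z : Fin n → H}, Orthonormal ℂ z → ∀ i, ∑ k, ‖⟪b i, z k⟫‖ ^ 2 ≤ 1 := by
    intro z hz i
    have := hz.sum_inner_products_le (b i) (s := Finset.univ)
    rw [b.orthonormal.1 i] at this
    simpa only [norm_inner_symm, one_pow] using this
  calc ∑ k, ‖⟪D (proj b F (x k)), proj b F (y k)⟫‖
      ≤ ∑ k, ∑ i ∈ F, ∑ j ∈ F, ‖⟪D (b i), b j⟫‖ * (‖⟪b i, x k⟫‖ * ‖⟪b j, y k⟫‖) := by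
        refine Finset.sum_le_sum fun k _ => ?_
        rw [proj_apply, proj_apply, map_sum, sum_inner]
        refine (norm_sum_le _ _).trans (Finset.sum_le_sum fun i _ => ?_)
        rw [inner_sum]
        refine (norm_sum_le _ _).trans (Finset.sum_le_sum fun j _ => le_of_eq ?_)
        rw [map_smul, inner_smul_left, inner_smul_right, norm_mul, norm_mul, RCLike.norm_conj]
        ring
    _ = ∑ i ∈ F, ∑ j ∈ F, ‖⟪D (b i), b j⟫‖ * ∑ k, (‖⟪b i, x k⟫‖ * ‖⟪b j, y k⟫‖) := by
        rw [Finset.sum_comm]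
        refine Finset.sum_congr rfl fun i _ => ?_
        rw [Finset.sum_comm]
        simp only [Finset.mul_sum]
    _ ≤ _ := by
        refine Finset.sum_le_sum fun i _ => Finset.sum_le_sum fun j _ => ?_
        refine mul_le_of_le_one_right (norm_nonneg _) ?_
        refine (Real.sum_mul_le_sqrt_mul_sqrt _ _ _).trans ?_
        exact mul_le_one₀ (Real.sqrt_le_one.2 (hbes hx i)) (Real.sqrt_nonneg _)
          (Real.sqrt_le_one.2 (hbes hy j))

theorem rest_le {ι : Type*} (b : HilbertBasis ι ℂ H) (F : Finset ι) {A : H →L[ℂ] H}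
    (hA : A.IsPositive) {t : ℝ} (ht : HasSum (fun i => (⟪b i, A (b i)⟫).re) t)
    {n : ℕ} {x y : Fin n → H} (hx : Orthonormal ℂ x) (hy : Orthonormal ℂ y) :
    ∑ k, ‖⟪A (x k), y k⟫ - ⟪A (proj b F (x k)), proj b F (y k)⟫‖ ≤
      2 * (√t * √(t - ∑ i ∈ F, (⟪b i, A (b i)⟫).re)) := by
  classical
  set s := ∑ i ∈ F, (⟪b i, A (b i)⟫).re with hs
  have hnn : ∀ i, 0 ≤ (⟪b i, A (b i)⟫).re := fun i => hA.re_inner_nonneg_right (b i)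
  have hst : s ≤ t := sum_le_hasSum F (fun i _ => hnn i) ht
  have hP : HasSum (fun i => (⟪proj b F (b i), A (proj b F (b i))⟫).re) s := by
    have : HasSum (fun i => (⟪proj b F (b i), A (proj b F (b i))⟫).re)
        (∑ i ∈ F, (⟪proj b F (b i), A (proj b F (b i))⟫).re) :=
      hasSum_sum_of_ne_finset_zero fun i hi => by simp [proj_basis, hi]
    convert this using 1
    refine Finset.sum_congr rfl fun i hi => ?_
    simp [proj_basis, hi]
  have hQ : HasSum (fun i => (⟪(1 - proj b F) (b i), A ((1 - proj b F) (b i))⟫).re) (t - s) := by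
    have hd := ht.sub hP
    refine (congrArg (fun f => HasSum f (t - s)) (funext fun i => ?_)).mpr hd
    by_cases hi : i ∈ F <;> simp [proj_basis, hi]
  have h1 := bilin_le b hA 1 (1 - proj b F) (by simpa using ht) hQ hx hy
  have h2 := bilin_le b hA (1 - proj b F) (proj b F) hQ hP hx hy
  calc _ ≤ ∑ k, (‖⟪A ((1 : H →L[ℂ] H) (x k)), (1 - proj b F) (y k)⟫‖
        + ‖⟪A ((1 - proj b F) (x k)), proj b F (y k)⟫‖) := by
        refine Finset.sum_le_sum fun k _ => ?_
        refine le_trans (le_of_eq ?_) (norm_add_le _ _)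
        congr 1
        simp [inner_sub_left, inner_sub_right]
    _ ≤ √t * √(t - s) + √(t - s) * √s := by
        rw [Finset.sum_add_distrib]; exact add_le_add h1 h2
    _ ≤ √t * √(t - s) + √(t - s) * √t := by gcongr
    _ = _ := by ring

theorem main_le {ι : Type*} (b : HilbertBasis ι ℂ H) (F : Finset ι) {A B : H →L[ℂ] H}
    (hA : A.IsPositive) (hB : B.IsPositive) {t u : ℝ}
    (ht : HasSum (fun i => (⟪b i, A (b i)⟫).re) t)
    (hu : HasSum (fun i => (⟪b i, B (b i)⟫).re) u) :
    traceNorm (A - B) ≤ ENNReal.ofReal (∑ i ∈ F, ∑ j ∈ F, ‖⟪(A - B) (b i), b j⟫‖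
      + 2 * (√t * √(t - ∑ i ∈ F, (⟪b i, A (b i)⟫).re))
      + 2 * (√u * √(u - ∑ i ∈ F, (⟪b i, B (b i)⟫).re))) := by
  refine traceNorm_le fun n x y hx hy => ?_
  refine le_trans ?_ (add_le_add (add_le_add (comp_le b F (A - B) hx hy) (rest_le b F hA ht hx hy))
    (rest_le b F hB hu hx hy))
  rw [← Finset.sum_add_distrib, ← Finset.sum_add_distrib]
  refine Finset.sum_le_sum fun k _ => ?_
  refine le_trans (le_of_eq ?_) ((norm_sub_le _ _).trans (add_le_add_left (norm_add_le _ _) _))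
  congr 1
  simp only [ContinuousLinearMap.sub_apply, inner_sub_left]
  ring

theorem hasSum_re {A : H →L[ℂ] H} (hA : traceNorm A ≠ ⊤) :
    HasSum (fun i => (⟪hBasis H i, A (hBasis H i)⟫).re) (opTrace A).re :=
  Complex.hasSum_re (summ (hBasis H) hA).hasSum

theorem isPositive_lim {A : ℕ → H →L[ℂ] H} (hpos : ∀ n, (A n).IsPositive) {B : H →L[ℂ] H}
    (hwot : ∀ x y : H, Tendsto (fun n => ⟪y, A n x⟫) atTop (𝓝 ⟪y, B x⟫)) : B.IsPositive := by
  rw [ContinuousLinearMap.isPositive_def]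
  have hsym : (B : H →ₗ[ℂ] H).IsSymmetric := fun x y => by
    have h1 := hwot y x
    have h2 := (Complex.continuous_conj.tendsto _).comp (hwot x y)
    refine tendsto_nhds_unique (f := fun n => ⟪x, A n y⟫) ?_ h1
    rw [inner_conj_symm] at h2
    refine h2.congr fun n => ?_
    simp only [Function.comp]
    rw [inner_conj_symm]
    exact (hpos n).isSymmetric x y
  refine ⟨hsym, fun x => ?_⟩
  have h1 := (Complex.continuous_re.tendsto _).comp (hwot x x)
  have h2 : 0 ≤ (⟪x, B x⟫).re := ge_of_tendsto' h1 fun n => (hpos n).re_inner_nonneg_right x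
  rw [ContinuousLinearMap.reApplyInnerSelf_apply, inner_re_symm]
  exact h2

end TraceAux

open TraceAux in
/-- if positive semidefinite trace class operators `A_n` converge in the
weak operator topology to a trace class `B`, then `‖A_n − B‖₁ → 0` iff `tr A_n → tr B`. -/
theorem traceNorm_tendsto_iff_trace_tendsto
    {H : Type*} [NormedAddCommGroup H] [InnerProductSpace ℂ H] [CompleteSpace H]
    [TopologicalSpace.SeparableSpace H]
    (A : ℕ → H →L[ℂ] H) (hpos : ∀ n, (A n).IsPositive) (htc : ∀ n, traceNorm (A n) ≠ ⊤)
    (B : H →L[ℂ] H) (hB : traceNorm B ≠ ⊤)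
    (hwot : ∀ x y : H, Tendsto (fun n => ⟪y, A n x⟫) atTop (𝓝 ⟪y, B x⟫)) :
    Tendsto (fun n => traceNorm (A n - B)) atTop (𝓝 0) ↔
      Tendsto (fun n => opTrace (A n)) atTop (𝓝 (opTrace B)) := by
  constructor
  · intro h
    have hfin : ∀ᶠ n in atTop, traceNorm (A n - B) ≠ ⊤ :=
      (h.eventually (gt_mem_nhds ENNReal.zero_lt_top)).mono fun n hn => hn.ne
    have h0 : Tendsto (fun n => (traceNorm (A n - B)).toReal) atTop (𝓝 0) :=
      (ENNReal.tendsto_toReal ENNReal.zero_ne_top).comp h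
    rw [tendsto_iff_norm_sub_tendsto_zero]
    refine squeeze_zero' (Eventually.of_forall fun _ => norm_nonneg _) ?_ h0
    filter_upwards [hfin] with n hn
    have he : opTrace (A n) - opTrace B = opTrace (A n - B) := by
      unfold opTrace
      rw [← (summ (hBasis H) (htc n)).tsum_sub (summ (hBasis H) hB)]
      simp [inner_sub_right]
    rw [he]
    exact norm_opTrace_le hn
  · intro h
    have hBp := isPositive_lim hpos hwot
    have hre := (Complex.continuous_re.tendsto _).comp h
    have hu := hasSum_re hB
    rw [ENNReal.tendsto_nhds_zero]
    intro ε hε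
    obtain ⟨δ, hδ, hδε⟩ : ∃ δ : ℝ, 0 < δ ∧ ENNReal.ofReal δ ≤ ε := by
      obtain ⟨r, hr0, hr⟩ := ENNReal.lt_iff_exists_nnreal_btwn.1 hε
      exact ⟨r, by exact_mod_cast hr0, by simpa using hr.le⟩
    set u := (opTrace B).re with hudef
    have hF : Tendsto (fun F : Finset (hIndex H) => 0
        + 2 * (√u * √(u - ∑ i ∈ F, (⟪hBasis H i, B (hBasis H i)⟫).re))
        + 2 * (√u * √(u - ∑ i ∈ F, (⟪hBasis H i, B (hBasis H i)⟫).re))) atTop (𝓝 0) := by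
      have h1 : Tendsto (fun F : Finset (hIndex H) =>
          ∑ i ∈ F, (⟪hBasis H i, B (hBasis H i)⟫).re) atTop (𝓝 u) := hu
      have h2 := ((h1.const_sub u).sqrt.const_mul (√u)).const_mul 2
      have h3 := (h2.const_add 0).add h2
      simpa using h3
    obtain ⟨F, hFδ⟩ := (hF.eventually (gt_mem_nhds hδ)).exists
    have hlim : Tendsto (fun n =>
        (∑ i ∈ F, ∑ j ∈ F, ‖⟪(A n - B) (hBasis H i), hBasis H j⟫‖)
        + 2 * (√(opTrace (A n)).re * √((opTrace (A n)).re
            - ∑ i ∈ F, (⟪hBasis H i, A n (hBasis H i)⟫).re))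
        + 2 * (√u * √(u - ∑ i ∈ F, (⟪hBasis H i, B (hBasis H i)⟫).re))) atTop
        (𝓝 (0 + 2 * (√u * √(u - ∑ i ∈ F, (⟪hBasis H i, B (hBasis H i)⟫).re))
        + 2 * (√u * √(u - ∑ i ∈ F, (⟪hBasis H i, B (hBasis H i)⟫).re)))) := by
      refine Tendsto.add (Tendsto.add ?_ (Tendsto.const_mul _ (Tendsto.mul hre.sqrt
        (Tendsto.sqrt (hre.sub (tendsto_finsetSum _ fun i _ =>
          (Complex.continuous_re.tendsto _).comp (hwot _ _))))))) tendsto_const_nhds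
      rw [show (0 : ℝ) = ∑ i ∈ F, ∑ j ∈ F, 0 by simp]
      refine tendsto_finsetSum _ fun i _ => tendsto_finsetSum _ fun j _ => ?_
      have := tendsto_iff_norm_sub_tendsto_zero.1 (hwot (hBasis H i) (hBasis H j))
      refine this.congr fun n => ?_
      rw [← inner_sub_right, norm_inner_symm]
      rfl
    filter_upwards [hlim.eventually (gt_mem_nhds hFδ)] with n hn
    exact (main_le (hBasis H) F (hpos n) hBp (hasSum_re (htc n)) hu).trans
      ((ENNReal.ofReal_le_ofReal hn.le).trans hδε)
end
end

section
/- Let ρ₁, ρ₂ be density operators on separable Hilbert spaces H₁, H₂. Then the set M(ρ₁,ρ₂) of positive semidefinite trace class operators ρ on H₁ ⊗ H₂ with tr₂ρ = ρ₁ and tr₁ρ = ρ₂ is nonempty, convex, and compact in the trace norm topology. -/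
noncomputable section

open Filter Topology

local notation "⟪" x ", " y "⟫" => @inner ℂ _ _ x y

/-- `tp` realizes `H` as the Hilbert tensor product of `H₁` and `H₂`:
it is bilinear, satisfies `⟪x ⊗ y, u ⊗ v⟫ = ⟪x, u⟫⟪y, v⟫`, and the span of the
elementary tensors is dense in `H`. -/
structure IsHilbertTensor {H₁ H₂ H : Type*}
    [NormedAddCommGroup H₁] [InnerProductSpace ℂ H₁]
    [NormedAddCommGroup H₂] [InnerProductSpace ℂ H₂]
    [NormedAddCommGroup H] [InnerProductSpace ℂ H]
    (tp : H₁ → H₂ → H) : Prop where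
  inner_tp : ∀ (x u : H₁) (y v : H₂), ⟪tp x y, tp u v⟫ = ⟪x, u⟫ * ⟪y, v⟫
  add_left : ∀ (x x' : H₁) (y : H₂), tp (x + x') y = tp x y + tp x' y
  smul_left : ∀ (c : ℂ) (x : H₁) (y : H₂), tp (c • x) y = c • tp x y
  add_right : ∀ (x : H₁) (y y' : H₂), tp x (y + y') = tp x y + tp x y'
  smul_right : ∀ (c : ℂ) (x : H₁) (y : H₂), tp x (c • y) = c • tp x y
  dense_span : Dense (Submodule.span ℂ {v : H | ∃ x y, v = tp x y} : Set H)

/-- `C` is the partial trace over `H₂` (denoted `tr₂ F`) of the operator `F` on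
`H = H₁ ⊗ H₂`: its matrix elements are `⟨(tr₂ F) x, y⟩ = ∑_j ⟨F (x ⊗ e_j), y ⊗ e_j⟩`
for a Hilbert basis `(e_j)` of `H₂`; this characterizes the map determined by
`tr₂((x⊗y)(u⊗v)*) = ⟨y,v⟩ x u*`. -/
def IsPartialTrace₂ {H₁ H₂ H : Type*}
    [NormedAddCommGroup H₁] [InnerProductSpace ℂ H₁] [CompleteSpace H₁]
    [NormedAddCommGroup H₂] [InnerProductSpace ℂ H₂] [CompleteSpace H₂]
    [NormedAddCommGroup H] [InnerProductSpace ℂ H]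
    (tp : H₁ → H₂ → H) (F : H →L[ℂ] H) (C : H₁ →L[ℂ] H₁) : Prop :=
  ∀ x y : H₁, ⟪y, C x⟫ = ∑' j : hIndex H₂, ⟪tp y (hBasis H₂ j), F (tp x (hBasis H₂ j))⟫

/-- `D` is the partial trace over `H₁` (denoted `tr₁ F`) of the operator `F` on
`H = H₁ ⊗ H₂`. -/
def IsPartialTrace₁ {H₁ H₂ H : Type*}
    [NormedAddCommGroup H₁] [InnerProductSpace ℂ H₁] [CompleteSpace H₁]
    [NormedAddCommGroup H₂] [InnerProductSpace ℂ H₂] [CompleteSpace H₂]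
    [NormedAddCommGroup H] [InnerProductSpace ℂ H]
    (tp : H₁ → H₂ → H) (F : H →L[ℂ] H) (D : H₂ →L[ℂ] H₂) : Prop :=
  ∀ u v : H₂, ⟪v, D u⟫ = ∑' i : hIndex H₁, ⟪tp (hBasis H₁ i) v, F (tp (hBasis H₁ i) u)⟫

/-- the set of positive semidefinite trace class operators on `H = H₁ ⊗ H₂` (described by
`tp`) with partial traces `ρ₁` and `ρ₂` -/
def couplings {H₁ H₂ H : Type*}
    [NormedAddCommGroup H₁] [InnerProductSpace ℂ H₁] [CompleteSpace H₁]
    [NormedAddCommGroup H₂] [InnerProductSpace ℂ H₂] [CompleteSpace H₂]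
    [NormedAddCommGroup H] [InnerProductSpace ℂ H] [CompleteSpace H]
    (tp : H₁ → H₂ → H) (ρ₁ : H₁ →L[ℂ] H₁) (ρ₂ : H₂ →L[ℂ] H₂) : Set (H →L[ℂ] H) :=
  {ρ | ρ.IsPositive ∧ traceNorm ρ ≠ ⊤ ∧ IsPartialTrace₂ tp ρ ρ₁ ∧ IsPartialTrace₁ tp ρ ρ₂}

section Aux

variable {E : Type*} [NormedAddCommGroup E] [InnerProductSpace ℂ E]

lemma aux_exists_sqrt [CompleteSpace E] {T : E →L[ℂ] E} (hT : T.IsPositive) :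
    ∃ S : E →L[ℂ] E, S.IsPositive ∧ ∀ x y, ⟪S x, S y⟫ = ⟪x, T y⟫ := by
  have h0 : 0 ≤ T := (ContinuousLinearMap.nonneg_iff_isPositive T).2 hT
  have hS : (CFC.sqrt T).IsPositive :=
    (ContinuousLinearMap.nonneg_iff_isPositive _).1 (CFC.sqrt_nonneg T)
  refine ⟨CFC.sqrt T, hS, fun x y => ?_⟩
  rw [hS.inner_left_eq_inner_right]
  congr 1
  exact DFunLike.congr_fun (CFC.sqrt_mul_sqrt_self T h0) y

lemma aux_parseval {ι : Type*} (b : HilbertBasis ι ℂ E) (x : E) :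
    ∑' i, ‖⟪b i, x⟫‖ₑ ^ 2 = ‖x‖ₑ ^ 2 := by
  have h := b.hasSum_inner_mul_inner x x
  have h2 : HasSum (fun i => ‖⟪b i, x⟫‖ ^ 2) (‖x‖ ^ 2) := by
    have := Complex.reCLM.hasSum h
    convert this using 1
    · ext i
      rw [Complex.reCLM_apply, ← inner_conj_symm x (b i), mul_comm, Complex.mul_conj,
        Complex.ofReal_re, Complex.normSq_eq_norm_sq]
    · simp [inner_self_eq_norm_sq_to_K, ← Complex.ofReal_pow]
  have h3 := ENNReal.ofReal_tsum_of_nonneg (fun i => by positivity) h2.summable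
  rw [h2.tsum_eq] at h3
  simp only [ENNReal.ofReal_pow (norm_nonneg _), ofReal_norm] at h3
  exact h3.symm

lemma aux_bessel {n : ℕ} {x : Fin n → E} (hx : Orthonormal ℂ x) (v : E) :
    ∑ k, ‖⟪x k, v⟫‖ₑ ^ 2 ≤ ‖v‖ₑ ^ 2 := by
  have h := hx.sum_inner_products_le v (s := Finset.univ)
  have := ENNReal.ofReal_le_ofReal h
  rw [ENNReal.ofReal_sum_of_nonneg (fun i _ => by positivity)] at this
  simpa only [ENNReal.ofReal_pow (norm_nonneg _), ofReal_norm] using this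

lemma aux_enorm_symm (x y : E) : ‖⟪x, y⟫‖ₑ = ‖⟪y, x⟫‖ₑ := by
  rw [← ofReal_norm, ← ofReal_norm, norm_inner_symm]

lemma aux_sum_le_hs [CompleteSpace E] {ι : Type*} (b : HilbertBasis ι ℂ E) (U : E →L[ℂ] E)
    {n : ℕ} {x : Fin n → E} (hx : Orthonormal ℂ x) :
    ∑ k, ‖U (x k)‖ₑ ^ 2 ≤ ∑' i, ‖U (b i)‖ₑ ^ 2 := by
  have h1 : ∑ k, ‖U (x k)‖ₑ ^ 2 = ∑' i, ∑ k, ‖⟪b i, U (x k)⟫‖ₑ ^ 2 := by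
    rw [Summable.tsum_finsetSum (fun _ _ => ENNReal.summable)]
    simp_rw [aux_parseval]
  have h2 : ∀ i, ∑ k, ‖⟪b i, U (x k)⟫‖ₑ ^ 2 ≤ ∑' j, ‖⟪b i, U (b j)⟫‖ₑ ^ 2 := by
    intro i
    have e : ∀ v, ‖⟪b i, U v⟫‖ₑ = ‖⟪v, U.adjoint (b i)⟫‖ₑ := fun v => by
      rw [ContinuousLinearMap.adjoint_inner_right, aux_enorm_symm]
    simp_rw [e]
    rw [aux_parseval]
    exact aux_bessel hx _
  rw [h1]
  refine (ENNReal.tsum_le_tsum h2).trans ?_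
  rw [ENNReal.tsum_comm]
  simp_rw [aux_parseval]
  exact le_rfl

lemma aux_sum_inner_le [CompleteSpace E] {ι : Type*} (b : HilbertBasis ι ℂ E) (U V : E →L[ℂ] E)
    {n : ℕ} {x y : Fin n → E} (hx : Orthonormal ℂ x) (hy : Orthonormal ℂ y) :
    ∑ k, ‖⟪U (x k), V (y k)⟫‖ₑ ≤
      (∑' i, ‖U (b i)‖ₑ ^ 2) ^ (1 / 2 : ℝ) * (∑' i, ‖V (b i)‖ₑ ^ 2) ^ (1 / 2 : ℝ) := by
  have h1 : ∑ k, ‖⟪U (x k), V (y k)⟫‖ₑ ≤ ∑ k, ‖U (x k)‖ₑ * ‖V (y k)‖ₑ := by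
    refine Finset.sum_le_sum fun k _ => ?_
    rw [← ofReal_norm, ← ofReal_norm, ← ofReal_norm, ← ENNReal.ofReal_mul (norm_nonneg _)]
    exact ENNReal.ofReal_le_ofReal (norm_inner_le_norm _ _)
  have h2 := ENNReal.inner_le_Lp_mul_Lq Finset.univ (fun k => ‖U (x k)‖ₑ) (fun k => ‖V (y k)‖ₑ)
    (p := 2) (q := 2) Real.HolderConjugate.two_two
  refine h1.trans (h2.trans ?_)
  simp only [ENNReal.rpow_ofNat]
  gcongr
  · exact aux_sum_le_hs b U hx
  · exact aux_sum_le_hs b V hy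

lemma aux_traceNorm_le {L : E →L[ℂ] E} {C : ENNReal}
    (h : ∀ (n : ℕ) (x y : Fin n → E), Orthonormal ℂ x → Orthonormal ℂ y →
      ∑ k, ‖⟪L (x k), y k⟫‖ₑ ≤ C) : traceNorm L ≤ C := by
  unfold traceNorm
  exact iSup_le fun n => iSup_le fun x => iSup_le fun hx => iSup_le fun y => iSup_le fun hy =>
    h n x y hx hy

lemma aux_le_traceNorm (L : E →L[ℂ] E) {n : ℕ} {x y : Fin n → E} (hx : Orthonormal ℂ x)
    (hy : Orthonormal ℂ y) : ∑ k, ‖⟪L (x k), y k⟫‖ₑ ≤ traceNorm L := by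
  unfold traceNorm
  exact le_iSup_of_le n <| le_iSup_of_le x <| le_iSup_of_le hx <| le_iSup_of_le y <|
    le_iSup_of_le hy le_rfl

lemma aux_traceNorm_add (L M : E →L[ℂ] E) : traceNorm (L + M) ≤ traceNorm L + traceNorm M := by
  refine aux_traceNorm_le fun n x y hx hy => ?_
  refine le_trans ?_ (add_le_add (aux_le_traceNorm L hx hy) (aux_le_traceNorm M hx hy))
  rw [← Finset.sum_add_distrib]
  refine Finset.sum_le_sum fun k _ => ?_
  rw [_root_.add_apply, inner_add_left]
  exact enorm_add_le _ _

lemma aux_traceNorm_smul_le (c : ℂ) (L : E →L[ℂ] E) : traceNorm (c • L) ≤ ‖c‖ₑ * traceNorm L := by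
  refine aux_traceNorm_le fun n x y hx hy => ?_
  refine le_trans ?_ (mul_le_mul_right (aux_le_traceNorm L hx hy) _)
  rw [Finset.mul_sum]
  refine Finset.sum_le_sum fun k _ => ?_
  rw [_root_.smul_apply, inner_smul_left, enorm_mul]
  simp [← ofReal_norm]

lemma aux_traceNorm_neg_le (L : E →L[ℂ] E) : traceNorm (-L) ≤ traceNorm L := by
  simpa using aux_traceNorm_smul_le (-1) L

lemma aux_traceNorm_sub_comm (L M : E →L[ℂ] E) : traceNorm (L - M) ≤ traceNorm (M - L) := by
  simpa using aux_traceNorm_neg_le (M - L)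

lemma aux_traceNorm_pos_le [CompleteSpace E] {ι : Type*} (b : HilbertBasis ι ℂ E) {T S : E →L[ℂ] E}
    (h : ∀ x y, ⟪S x, S y⟫ = ⟪x, T y⟫) :
    traceNorm T ≤ ∑' i, ‖S (b i)‖ₑ ^ 2 := by
  refine aux_traceNorm_le fun n x y hx hy => ?_
  have := aux_sum_inner_le b S S hy hx
  rw [← ENNReal.rpow_add_of_nonneg _ _ (by norm_num) (by norm_num)] at this
  norm_num at this
  simp_rw [h] at this
  simp_rw [aux_enorm_symm (T _)]
  exact this

end Aux

section Aux2

variable {E : Type*} [NormedAddCommGroup E] [InnerProductSpace ℂ E]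

lemma aux_sqrt_left {T S : E →L[ℂ] E} (h : ∀ x y, ⟪S x, S y⟫ = ⟪x, T y⟫) (x y : E) :
    ⟪T x, y⟫ = ⟪S x, S y⟫ := by
  rw [← inner_conj_symm, ← h, inner_conj_symm]

lemma aux_tsum_le_traceNorm {κ : Type*} (L : E →L[ℂ] E) {x y : κ → E} (hx : Orthonormal ℂ x)
    (hy : Orthonormal ℂ y) : ∑' j, ‖⟪L (x j), y j⟫‖ₑ ≤ traceNorm L := by
  rw [ENNReal.tsum_eq_iSup_sum]
  refine iSup_le fun s => ?_
  have hinj : Function.Injective (fun k : Fin s.card => ((s.equivFin.symm k : s) : κ)) :=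
    Subtype.val_injective.comp s.equivFin.symm.injective
  have := aux_le_traceNorm L (hx.comp _ hinj) (hy.comp _ hinj)
  refine le_trans (le_of_eq ?_) this
  rw [← Finset.sum_coe_sort s]
  exact (Equiv.sum_comp s.equivFin.symm (fun j : s => ‖⟪L (x j), y j⟫‖ₑ)).symm

lemma aux_unit {x : E} (hx : x ≠ 0) : ∃ u : E, ‖u‖ = 1 ∧ x = (‖x‖ : ℂ) • u := by
  refine ⟨((‖x‖ : ℂ)⁻¹) • x, ?_, ?_⟩
  · have : ‖x‖ ≠ 0 := norm_ne_zero_iff.2 hx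
    simp [norm_smul, this]
  · have : (‖x‖ : ℂ) ≠ 0 := by simpa using hx
    rw [smul_smul, mul_inv_cancel₀ this, one_smul]

lemma aux_inner_le_traceNorm (L : E →L[ℂ] E) (x y : E) :
    ‖⟪L x, y⟫‖ₑ ≤ ‖x‖ₑ * ‖y‖ₑ * traceNorm L := by
  by_cases hx : x = 0
  · simp [hx]
  by_cases hy : y = 0
  · simp [hy]
  obtain ⟨u, hu, hxu⟩ := aux_unit hx
  obtain ⟨v, hv, hyv⟩ := aux_unit hy
  have h1 : ∀ w : E, ‖w‖ = 1 → Orthonormal ℂ (fun _ : Unit => w) := fun w hw =>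
    ⟨fun _ => hw, fun i j hij => (hij (Subsingleton.elim _ _)).elim⟩
  have := aux_tsum_le_traceNorm L (h1 u hu) (h1 v hv)
  rw [tsum_fintype] at this
  simp only [Finset.univ_unique, Finset.sum_const, Finset.card_singleton, one_smul] at this
  have e : ⟪L x, y⟫ = (‖x‖ : ℂ) * (‖y‖ : ℂ) * ⟪L u, v⟫ := by
    conv_lhs => rw [hxu, hyv]
    rw [map_smul, inner_smul_left, inner_smul_right]
    simp [mul_assoc]
  rw [e, enorm_mul, enorm_mul]
  have h2 : ∀ w : E, ‖(‖w‖ : ℂ)‖ₑ = ‖w‖ₑ := fun w => by rw [← ofReal_norm]; simp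
  rw [h2, h2]
  gcongr

lemma aux_opNorm_le (L : E →L[ℂ] E) {C : ℝ} (hC : 0 ≤ C) (h : traceNorm L ≤ ENNReal.ofReal C) :
    ‖L‖ ≤ C := by
  refine L.opNorm_le_bound hC fun x => ?_
  have h1 := (aux_inner_le_traceNorm L x (L x)).trans (mul_le_mul_right h _)
  rw [← ofReal_norm, ← ofReal_norm, ← ofReal_norm, ← ENNReal.ofReal_mul (by positivity),
    ← ENNReal.ofReal_mul (by positivity), ENNReal.ofReal_le_ofReal_iff (by positivity)] at h1
  have h2 : ‖⟪L x, L x⟫‖ = ‖L x‖ * ‖L x‖ := by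
    rw [inner_self_eq_norm_sq_to_K]; simp [sq]
  rw [h2] at h1
  by_cases h0 : ‖L x‖ = 0
  · rw [h0]; positivity
  · have : 0 < ‖L x‖ := lt_of_le_of_ne (norm_nonneg _) (Ne.symm h0)
    nlinarith

/-- finite rank projection -/
def auxProj {ι : Type*} (b : ι → E) (F : Finset ι) : E →L[ℂ] E :=
  ∑ p ∈ F, InnerProductSpace.rankOne ℂ (b p) (b p)

lemma auxProj_apply {ι : Type*} (b : ι → E) (F : Finset ι) (x : E) :
    auxProj b F x = ∑ p ∈ F, ⟪b p, x⟫ • b p := by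
  simp [auxProj]

lemma auxProj_basis {ι : Type*} [DecidableEq ι] {b : ι → E} (hb : Orthonormal ℂ b) (F : Finset ι) (i : ι) :
    auxProj b F (b i) = if i ∈ F then b i else 0 := by
  rw [auxProj_apply]
  simp_rw [orthonormal_iff_ite.1 hb]
  simp

lemma aux_finite_part {ι : Type*} {b : ι → E} (hb : Orthonormal ℂ b) (F : Finset ι)
    (A : E →L[ℂ] E) {n : ℕ} {x y : Fin n → E} (hx : Orthonormal ℂ x) (hy : Orthonormal ℂ y) :
    ∑ k, ‖⟪A (auxProj b F (x k)), auxProj b F (y k)⟫‖ₑ ≤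
      ∑ p ∈ F, ∑ q ∈ F, ‖⟪A (b p), b q⟫‖ₑ := by
  have h1 : ∀ k, ‖⟪A (auxProj b F (x k)), auxProj b F (y k)⟫‖ₑ ≤
      ∑ p ∈ F, ∑ q ∈ F, ‖⟪A (b p), b q⟫‖ₑ * (‖⟪x k, b p⟫‖ₑ * ‖⟪y k, b q⟫‖ₑ) := by
    intro k
    rw [auxProj_apply, auxProj_apply, map_sum, sum_inner]
    refine (enorm_sum_le _ _).trans (Finset.sum_le_sum fun p _ => ?_)
    rw [inner_sum]
    refine (enorm_sum_le _ _).trans (Finset.sum_le_sum fun q _ => ?_)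
    rw [map_smul, inner_smul_left, inner_smul_right, inner_conj_symm, enorm_mul, enorm_mul,
      aux_enorm_symm (b q) (y k)]
    apply le_of_eq; ring
  refine (Finset.sum_le_sum fun k _ => h1 k).trans ?_
  rw [Finset.sum_comm]
  refine Finset.sum_le_sum fun p _ => ?_
  rw [Finset.sum_comm]
  refine Finset.sum_le_sum fun q _ => ?_
  rw [← Finset.mul_sum]
  refine (mul_le_mul_right (b := ∑ k, ‖⟪x k, b p⟫‖ₑ * ‖⟪y k, b q⟫‖ₑ) (c := 1) ?_ _).trans
    (by rw [mul_one])
  have h2 := ENNReal.inner_le_Lp_mul_Lq Finset.univ (fun k => ‖⟪x k, b p⟫‖ₑ)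
    (fun k => ‖⟪y k, b q⟫‖ₑ) (p := 2) (q := 2) Real.HolderConjugate.two_two
  refine h2.trans ?_
  simp only [ENNReal.rpow_ofNat]
  have h3 : ∀ p, ‖b p‖ₑ = 1 := fun p => by rw [← ofReal_norm, hb.1 p]; simp
  have h4 := aux_bessel hx (b p)
  have h5 := aux_bessel hy (b q)
  rw [h3, one_pow] at h4 h5
  calc _ ≤ (1 : ENNReal) ^ (1 / 2 : ℝ) * (1 : ENNReal) ^ (1 / 2 : ℝ) := by gcongr
    _ = 1 := by simp

lemma aux_tail_part [CompleteSpace E] {ι : Type*} [DecidableEq ι] (b : HilbertBasis ι ℂ E) (F : Finset ι)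
    {T S : E →L[ℂ] E} (h : ∀ x y, ⟪S x, S y⟫ = ⟪x, T y⟫)
    (h1 : ∑' i, ‖S (b i)‖ₑ ^ 2 ≤ 1) {δ : ENNReal}
    (hδ : ∑' i, (if i ∈ F then 0 else ‖S (b i)‖ₑ ^ 2) ≤ δ)
    {n : ℕ} {x y : Fin n → E} (hx : Orthonormal ℂ x) (hy : Orthonormal ℂ y) :
    ∑ k, ‖⟪T (x k), y k⟫ - ⟪T (auxProj b F (x k)), auxProj b F (y k)⟫‖ₑ ≤
      2 * δ ^ (1 / 2 : ℝ) := by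
  set P := auxProj b F with hP
  have hSP : ∑' i, ‖(S ∘L P) (b i)‖ₑ ^ 2 ≤ 1 := by
    refine le_trans (ENNReal.tsum_le_tsum fun i => ?_) h1
    rw [ContinuousLinearMap.comp_apply, hP, auxProj_basis b.orthonormal]
    split_ifs <;> simp
  have hSQ : ∑' i, ‖(S ∘L (1 - P)) (b i)‖ₑ ^ 2 ≤ δ := by
    refine le_trans (ENNReal.tsum_le_tsum fun i => ?_) hδ
    rw [ContinuousLinearMap.comp_apply, _root_.sub_apply, hP, auxProj_basis b.orthonormal]
    split_ifs <;> simp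
  have e : ∀ k, ⟪T (x k), y k⟫ - ⟪T (P (x k)), P (y k)⟫ =
      ⟪(S ∘L (1 - P)) (x k), S (y k)⟫ + ⟪(S ∘L P) (x k), (S ∘L (1 - P)) (y k)⟫ := by
    intro k
    rw [aux_sqrt_left h, aux_sqrt_left h]
    simp only [ContinuousLinearMap.comp_apply, _root_.sub_apply, map_sub, inner_sub_left,
      inner_sub_right, one_apply_eq_self]
    ring
  simp_rw [e]
  have a1 := aux_sum_inner_le b (S ∘L (1 - P)) S hx hy
  have a2 := aux_sum_inner_le b (S ∘L P) (S ∘L (1 - P)) hx hy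
  refine (Finset.sum_le_sum fun k _ => enorm_add_le _ _).trans ?_
  rw [Finset.sum_add_distrib, two_mul]
  refine add_le_add (a1.trans ?_) (a2.trans ?_)
  · calc _ ≤ δ ^ (1 / 2 : ℝ) * (1 : ENNReal) ^ (1 / 2 : ℝ) := by gcongr
      _ = _ := by simp
  · calc _ ≤ (1 : ENNReal) ^ (1 / 2 : ℝ) * δ ^ (1 / 2 : ℝ) := by gcongr
      _ = _ := by simp

lemma aux_traceNorm_sub_le [CompleteSpace E] {ι : Type*} [DecidableEq ι] (b : HilbertBasis ι ℂ E) (F : Finset ι)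
    {T S T' S' : E →L[ℂ] E} (h : ∀ x y, ⟪S x, S y⟫ = ⟪x, T y⟫)
    (h' : ∀ x y, ⟪S' x, S' y⟫ = ⟪x, T' y⟫)
    (h1 : ∑' i, ‖S (b i)‖ₑ ^ 2 ≤ 1) (h1' : ∑' i, ‖S' (b i)‖ₑ ^ 2 ≤ 1) {δ : ENNReal}
    (hδ : ∑' i, (if i ∈ F then 0 else ‖S (b i)‖ₑ ^ 2) ≤ δ)
    (hδ' : ∑' i, (if i ∈ F then 0 else ‖S' (b i)‖ₑ ^ 2) ≤ δ) :
    traceNorm (T - T') ≤ 2 * δ ^ (1 / 2 : ℝ) + 2 * δ ^ (1 / 2 : ℝ) +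
      ∑ p ∈ F, ∑ q ∈ F, ‖⟪(T - T') (b p), b q⟫‖ₑ := by
  refine aux_traceNorm_le fun n x y hx hy => ?_
  have a1 := aux_tail_part b F h h1 hδ hx hy
  have a2 := aux_tail_part b F h' h1' hδ' hx hy
  have a3 := aux_finite_part b.orthonormal F (T - T') hx hy
  refine le_trans ?_ (add_le_add (add_le_add a1 a2) a3)
  rw [← Finset.sum_add_distrib, ← Finset.sum_add_distrib]
  refine Finset.sum_le_sum fun k _ => ?_
  have e : ⟪(T - T') (x k), y k⟫ =
      ((⟪T (x k), y k⟫ - ⟪T (auxProj b F (x k)), auxProj b F (y k)⟫) -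
      (⟪T' (x k), y k⟫ - ⟪T' (auxProj b F (x k)), auxProj b F (y k)⟫)) +
      ⟪(T - T') (auxProj b F (x k)), auxProj b F (y k)⟫ := by
    simp only [_root_.sub_apply, inner_sub_left]
    ring
  rw [e]
  exact (enorm_add_le _ _).trans (add_le_add enorm_sub_le le_rfl)

end Aux2

section Aux3

set_option linter.unusedSectionVars false

variable {E : Type*} [NormedAddCommGroup E] [InnerProductSpace ℂ E]
variable {H₁ H₂ H : Type*}
  [NormedAddCommGroup H₁] [InnerProductSpace ℂ H₁] [CompleteSpace H₁]
  [NormedAddCommGroup H₂] [InnerProductSpace ℂ H₂] [CompleteSpace H₂]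
  [NormedAddCommGroup H] [InnerProductSpace ℂ H] [CompleteSpace H]

lemma aux_isPositive_of_tendsto {α : Type*} {l : Filter α} [l.NeBot] {G : α → E →L[ℂ] E}
    {g : E →L[ℂ] E} (h : Tendsto G l (𝓝 g)) (hG : ∀ a, (G a).IsPositive) : g.IsPositive := by
  rw [ContinuousLinearMap.isPositive_iff_complex]
  intro x
  have h1 : Tendsto (fun a => ⟪G a x, x⟫) l (𝓝 ⟪g x, x⟫) :=
    ((ContinuousLinearMap.apply ℂ E x).continuous.tendsto g |>.comp h).inner tendsto_const_nhds
  have h2 : Tendsto (fun a => (⟪G a x, x⟫ : ℂ).re) l (𝓝 (⟪g x, x⟫ : ℂ).re) :=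
    (Complex.continuous_re.tendsto _).comp h1
  have h3 : Tendsto (fun a => (((⟪G a x, x⟫ : ℂ).re : ℝ) : ℂ)) l (𝓝 (((⟪g x, x⟫ : ℂ).re : ℝ) : ℂ)) :=
    (Complex.continuous_ofReal.tendsto _).comp h2
  have hp := fun a => (ContinuousLinearMap.isPositive_iff_complex (G a)).1 (hG a) x
  refine ⟨?_, ge_of_tendsto' h2 fun a => (hp a).2⟩
  refine tendsto_nhds_unique h3 (h1.congr fun a => ((hp a).1).symm)

lemma aux_swap {tp : H₁ → H₂ → H} (htp : IsHilbertTensor tp) :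
    IsHilbertTensor (fun y x => tp x y) where
  inner_tp x u y v := by rw [htp.inner_tp, mul_comm]
  add_left x x' y := htp.add_right _ _ _
  smul_left c x y := htp.smul_right _ _ _
  add_right x y y' := htp.add_left _ _ _
  smul_right c x y := htp.smul_left _ _ _
  dense_span := by
    convert htp.dense_span using 5
    exact exists_comm

lemma aux_norm_tp {tp : H₁ → H₂ → H} (htp : IsHilbertTensor tp) (x : H₁) (y : H₂) :
    ‖tp x y‖ = ‖x‖ * ‖y‖ := by
  have h := htp.inner_tp x x y y
  simp only [inner_self_eq_norm_sq_to_K] at h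
  have h2 : ‖tp x y‖ ^ 2 = (‖x‖ * ‖y‖) ^ 2 := by
    rw [mul_pow]
    apply Complex.ofReal_injective
    push_cast
    exact h
  exact (pow_left_inj₀ (by positivity) (by positivity) two_ne_zero).1 h2

/-- `tp x` as a continuous linear map -/
def auxTpL {tp : H₁ → H₂ → H} (htp : IsHilbertTensor tp) (x : H₁) : H₂ →L[ℂ] H :=
  LinearMap.mkContinuous
    { toFun := tp x, map_add' := htp.add_right x, map_smul' := fun c y => htp.smul_right c x y }
    ‖x‖ (fun y => (aux_norm_tp htp x y).le)

lemma aux_eq_zero_of_basis {ι : Type*} (b : HilbertBasis ι ℂ H₁) (f : H₁ →L[ℂ] ℂ)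
    (h : ∀ i, f (b i) = 0) : f = 0 := by
  ext x
  have h1 := f.hasSum (b.hasSum_repr x)
  simp only [map_smul, h, smul_zero] at h1
  exact h1.unique hasSum_zero

lemma aux_orthonormal_tp {tp : H₁ → H₂ → H} (htp : IsHilbertTensor tp)
    {ι κ : Type*} {e : ι → H₁} {f : κ → H₂} (he : Orthonormal ℂ e) (hf : Orthonormal ℂ f) :
    Orthonormal ℂ (fun p : ι × κ => tp (e p.1) (f p.2)) := by
  classical
  rw [orthonormal_iff_ite] at *
  intro p q
  rw [htp.inner_tp, he, hf]
  by_cases h1 : p.1 = q.1 <;> by_cases h2 : p.2 = q.2 <;> simp [Prod.ext_iff, h1, h2]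

lemma aux_exists_basis {tp : H₁ → H₂ → H} (htp : IsHilbertTensor tp)
    {ι κ : Type*} (e : HilbertBasis ι ℂ H₁) (f : HilbertBasis κ ℂ H₂) :
    ∃ b : HilbertBasis (ι × κ) ℂ H, ∀ p, b p = tp (e p.1) (f p.2) := by
  have ho := aux_orthonormal_tp htp e.orthonormal f.orthonormal
  have hs : (Submodule.span ℂ (Set.range fun p : ι × κ => tp (e p.1) (f p.2)))ᗮ = ⊥ := by
    rw [Submodule.eq_bot_iff]
    intro v hv
    have h0 : ∀ i j, ⟪v, tp (e i) (f j)⟫ = 0 := fun i j =>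
      (Submodule.mem_orthogonal' _ _).1 hv _ (Submodule.subset_span ⟨(i, j), rfl⟩)
    have h1 : ∀ i y, ⟪v, tp (e i) y⟫ = 0 := fun i y =>
      DFunLike.congr_fun (aux_eq_zero_of_basis f ((innerSL ℂ v) ∘L (auxTpL htp (e i)))
        (fun j => h0 i j)) y
    have h2 : ∀ x y, ⟪v, tp x y⟫ = 0 := fun x y =>
      DFunLike.congr_fun (aux_eq_zero_of_basis e ((innerSL ℂ v) ∘L (auxTpL (aux_swap htp) y))
        (fun i => h1 i y)) x
    have h3 : (Submodule.span ℂ {v : H | ∃ x y, v = tp x y}) ≤ (innerSL ℂ v).ker := by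
      rw [Submodule.span_le]
      rintro _ ⟨x, y, rfl⟩
      exact h2 x y
    have h4 : (innerSL ℂ v : H → ℂ) = fun _ => 0 :=
      Continuous.ext_on htp.dense_span (innerSL ℂ v).continuous continuous_const
        (fun w hw => h3 hw)
    exact inner_self_eq_zero.1 (congrFun h4 v)
  exact ⟨HilbertBasis.mkOfOrthogonalEqBot ho hs, fun p => by
    rw [HilbertBasis.coe_mkOfOrthogonalEqBot]⟩

lemma aux_pt_le {tp : H₁ → H₂ → H} (htp : IsHilbertTensor tp) {κ : Type*} {f : κ → H₂}
    (hf : Orthonormal ℂ f) (L : H →L[ℂ] H) (x y : H₁) :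
    ∑' j, ‖⟪tp y (f j), L (tp x (f j))⟫‖ₑ ≤ ‖x‖ₑ * ‖y‖ₑ * traceNorm L := by
  have hz : ∀ j, tp 0 (f j) = 0 := fun j => by
    rw [← norm_eq_zero, aux_norm_tp htp]; simp
  by_cases hx : x = 0
  · simp [hx, hz]
  by_cases hy : y = 0
  · simp [hy, hz]
  obtain ⟨u, hu, hxu⟩ := aux_unit hx
  obtain ⟨v, hv, hyv⟩ := aux_unit hy
  have h1 : ∀ w : H₁, ‖w‖ = 1 → Orthonormal ℂ (fun j => tp w (f j)) := fun w hw => by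
    have := aux_orthonormal_tp htp (e := fun _ : Unit => w)
      ⟨fun _ => hw, fun i j hij => (hij (Subsingleton.elim _ _)).elim⟩ hf
    exact this.comp (fun j => ((), j)) (fun i j h => (Prod.ext_iff.1 h).2)
  have := aux_tsum_le_traceNorm L (h1 u hu) (h1 v hv)
  have h2 : ∀ w : H₁, ‖(‖w‖ : ℂ)‖ₑ = ‖w‖ₑ := fun w => by rw [← ofReal_norm]; simp
  have e : ∀ j, ‖⟪tp y (f j), L (tp x (f j))⟫‖ₑ =
      ‖x‖ₑ * ‖y‖ₑ * ‖⟪L (tp u (f j)), tp v (f j)⟫‖ₑ := by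
    intro j
    rw [aux_enorm_symm]
    conv_lhs => rw [hxu, hyv]
    rw [htp.smul_left, htp.smul_left, map_smul, inner_smul_left, inner_smul_right, enorm_mul,
      enorm_mul, RCLike.enorm_conj, h2, h2, mul_assoc]
  simp_rw [e]
  rw [ENNReal.tsum_mul_left]
  gcongr

lemma aux_pt_summable {tp : H₁ → H₂ → H} (htp : IsHilbertTensor tp) {κ : Type*} {f : κ → H₂}
    (hf : Orthonormal ℂ f) {L : H →L[ℂ] H} (hL : traceNorm L ≠ ⊤) (x y : H₁) :
    Summable (fun j => ⟪tp y (f j), L (tp x (f j))⟫) := by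
  have h := aux_pt_le htp hf L x y
  have h2 : ∑' j, ‖⟪tp y (f j), L (tp x (f j))⟫‖ₑ ≠ ⊤ :=
    ne_top_of_le_ne_top (ENNReal.mul_ne_top (ENNReal.mul_ne_top enorm_ne_top enorm_ne_top) hL) h
  refine Summable.of_norm ?_
  have h3 := ENNReal.summable_toReal h2
  simpa using h3

lemma aux_pt_limit {tp : H₁ → H₂ → H} (htp : IsHilbertTensor tp) {G : ℕ → H →L[ℂ] H}
    {g : H →L[ℂ] H} {C : H₁ →L[ℂ] H₁} (hG : ∀ k, traceNorm (G k) ≠ ⊤)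
    (hpt : ∀ k, IsPartialTrace₂ tp (G k) C) (hg : traceNorm g ≠ ⊤)
    (hlim : Tendsto (fun k => traceNorm (G k - g)) atTop (𝓝 0)) : IsPartialTrace₂ tp g C := by
  intro x y
  have hf := (hBasis H₂).orthonormal
  have h1 : ∀ k, ‖⟪y, C x⟫ - ∑' j : hIndex H₂, ⟪tp y (hBasis H₂ j), g (tp x (hBasis H₂ j))⟫‖ₑ ≤
      ‖x‖ₑ * ‖y‖ₑ * traceNorm (G k - g) := by
    intro k
    rw [hpt k x y, ← Summable.tsum_sub (aux_pt_summable htp hf (hG k) x y)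
      (aux_pt_summable htp hf hg x y)]
    refine le_trans ?_ (aux_pt_le htp hf (G k - g) x y)
    simp_rw [← inner_sub_right, ← _root_.sub_apply]
    exact enorm_tsum_le_tsum_enorm
  have h2 : Tendsto (fun k => ‖x‖ₑ * ‖y‖ₑ * traceNorm (G k - g)) atTop (𝓝 (‖x‖ₑ * ‖y‖ₑ * 0)) :=
    ENNReal.Tendsto.const_mul hlim (Or.inr (ENNReal.mul_ne_top enorm_ne_top enorm_ne_top))
  rw [mul_zero] at h2
  have h3 := ge_of_tendsto' h2 h1
  rw [nonpos_iff_eq_zero, enorm_eq_zero, sub_eq_zero] at h3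
  exact h3

lemma aux_pt_combo {tp : H₁ → H₂ → H} (htp : IsHilbertTensor tp) {ρ σ : H →L[ℂ] H}
    {C : H₁ →L[ℂ] H₁} (h1 : traceNorm ρ ≠ ⊤) (h2 : traceNorm σ ≠ ⊤)
    (hρ : IsPartialTrace₂ tp ρ C) (hσ : IsPartialTrace₂ tp σ C) (t : ℂ) :
    IsPartialTrace₂ tp (t • ρ + (1 - t) • σ) C := by
  intro x y
  have hf := (hBasis H₂).orthonormal
  simp only [_root_.add_apply, _root_.smul_apply, inner_add_right, inner_smul_right]
  rw [Summable.tsum_add ((aux_pt_summable htp hf h1 x y).mul_left t)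
    ((aux_pt_summable htp hf h2 x y).mul_left _), tsum_mul_left, tsum_mul_left, ← hρ, ← hσ]
  ring

lemma aux_sqrt_self {T S : H →L[ℂ] H} (h : ∀ x y, ⟪S x, S y⟫ = ⟪x, T y⟫) (x : H) :
    ⟪x, T x⟫ = ((‖S x‖ ^ 2 : ℝ) : ℂ) := by
  rw [← h, inner_self_eq_norm_sq_to_K]; simp

lemma aux_marginal {tp : H₁ → H₂ → H} (htp : IsHilbertTensor tp) {γ S : H →L[ℂ] H}
    {C : H₁ →L[ℂ] H₁} (hγ : traceNorm γ ≠ ⊤) (h : ∀ x y, ⟪S x, S y⟫ = ⟪x, γ y⟫)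
    (hpt : IsPartialTrace₂ tp γ C) (x : H₁) :
    ∑' j, ‖S (tp x (hBasis H₂ j))‖ₑ ^ 2 = ENNReal.ofReal (⟪x, C x⟫ : ℂ).re := by
  have hs := aux_pt_summable htp (hBasis H₂).orthonormal hγ x x
  have e := hpt x x
  simp_rw [aux_sqrt_self h] at hs e
  rw [← Complex.ofReal_tsum] at e
  rw [e, Complex.ofReal_re, ENNReal.ofReal_tsum_of_nonneg (fun _ => by positivity)
    (Complex.summable_ofReal.1 hs)]
  simp only [ENNReal.ofReal_pow (norm_nonneg _), ofReal_norm]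

lemma aux_opTrace {ρ S : H →L[ℂ] H} (h : ∀ x y, ⟪S x, S y⟫ = ⟪x, ρ y⟫) (htr : opTrace ρ = 1) :
    HasSum (fun i => ‖S (hBasis H i)‖ ^ 2) 1 := by
  unfold opTrace at htr
  have hs : Summable fun i : hIndex H => ⟪(hBasis H i : H), ρ (hBasis H i)⟫ := by
    by_contra hc
    rw [tsum_eq_zero_of_not_summable hc] at htr
    exact zero_ne_one htr
  have := hs.hasSum
  rw [htr] at this
  simp_rw [aux_sqrt_self h] at this
  exact Complex.hasSum_ofReal.1 (by simpa using this)

lemma aux_opTrace_enn {ρ : H →L[ℂ] H} (hpos : ρ.IsPositive) (htr : opTrace ρ = 1) :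
    ∑' i, ENNReal.ofReal (⟪(hBasis H i : H), ρ (hBasis H i)⟫ : ℂ).re = 1 := by
  obtain ⟨S, -, h⟩ := aux_exists_sqrt hpos
  have h1 := aux_opTrace h htr
  simp_rw [aux_sqrt_self h, Complex.ofReal_re]
  rw [← ENNReal.ofReal_tsum_of_nonneg (fun _ => by positivity) h1.summable, h1.tsum_eq]
  simp

end Aux3

section Aux4

set_option linter.unusedSectionVars false

variable {H₁ H₂ H : Type*}
  [NormedAddCommGroup H₁] [InnerProductSpace ℂ H₁] [CompleteSpace H₁]
  [NormedAddCommGroup H₂] [InnerProductSpace ℂ H₂] [CompleteSpace H₂]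
  [NormedAddCommGroup H] [InnerProductSpace ℂ H] [CompleteSpace H]

lemma aux_sqrt_hasSum {ι : Type*} (b : HilbertBasis ι ℂ H) {ρ S : H →L[ℂ] H} (hS : S.IsPositive)
    (h : ∀ x y, ⟪S x, S y⟫ = ⟪x, ρ y⟫) (x y : H) :
    HasSum (fun i => ⟪y, S (b i)⟫ * ⟪S (b i), x⟫) ⟪y, ρ x⟫ := by
  have := b.hasSum_inner_mul_inner (S y) (S x)
  rw [h] at this
  have e : (fun i => ⟪y, S (b i)⟫ * ⟪S (b i), x⟫) =
      fun i => ⟪S y, b i⟫ * ⟪b i, S x⟫ := funext fun i => by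
    rw [hS.inner_left_eq_inner_right, hS.inner_left_eq_inner_right]
  rw [e]
  exact this

lemma aux_mul_hasSum {ι κ : Type*} {f : ι → ℂ} {g : κ → ℂ} {s t : ℂ} (hf : HasSum f s)
    (hg : HasSum g t) {F : ι × κ → ℂ} {r : ℂ} (hF : HasSum F r)
    (h : ∀ p, F p = f p.1 * g p.2) : r = s * t := by
  have e : F = fun p : ι × κ => f p.1 * g p.2 := funext h
  rw [e] at hF
  exact hF.unique (hf.mul hg hF.summable)

lemma aux_exists_prod {tp : H₁ → H₂ → H} (htp : IsHilbertTensor tp)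
    {ρ₁ : H₁ →L[ℂ] H₁} (hρ₁pos : ρ₁.IsPositive) (hρ₁tr : opTrace ρ₁ = 1)
    {ρ₂ : H₂ →L[ℂ] H₂} (hρ₂pos : ρ₂.IsPositive) (hρ₂tr : opTrace ρ₂ = 1) :
    ∃ R : H →L[ℂ] H, R.IsPositive ∧
      ∀ x y u v, ⟪tp y v, R (tp x u)⟫ = ⟪y, ρ₁ x⟫ * ⟪v, ρ₂ u⟫ := by
  obtain ⟨S₁, hS₁, h₁⟩ := aux_exists_sqrt hρ₁pos
  obtain ⟨S₂, hS₂, h₂⟩ := aux_exists_sqrt hρ₂pos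
  set w : hIndex H₁ × hIndex H₂ → H := fun p => tp (S₁ (hBasis H₁ p.1)) (S₂ (hBasis H₂ p.2)) with hw
  have hsum : Summable fun p => InnerProductSpace.rankOne ℂ (w p) (w p) := by
    refine Summable.of_norm ?_
    have := (aux_opTrace h₁ hρ₁tr).summable.mul_of_nonneg (aux_opTrace h₂ hρ₂tr).summable
      (fun _ => by positivity) (fun _ => by positivity)
    refine this.congr fun p => ?_
    rw [InnerProductSpace.norm_rankOne, hw, aux_norm_tp htp]
    ring
  refine ⟨∑' p, InnerProductSpace.rankOne ℂ (w p) (w p), ?_, ?_⟩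
  · refine aux_isPositive_of_tendsto (l := atTop) hsum.hasSum fun s => ?_
    induction s using Finset.cons_induction with
    | empty => simp
    | cons a s ha ih =>
      rw [Finset.sum_cons]
      exact (InnerProductSpace.isPositive_rankOne_self _).add ih
  · intro x y u v
    have a1 := ((innerSL ℂ (tp y v)) ∘L (ContinuousLinearMap.apply ℂ H (tp x u))).hasSum hsum.hasSum
    have a2 : HasSum (fun p : hIndex H₁ × hIndex H₂ =>
        (⟪y, S₁ (hBasis H₁ p.1)⟫ * ⟪S₁ (hBasis H₁ p.1), x⟫) *
        (⟪v, S₂ (hBasis H₂ p.2)⟫ * ⟪S₂ (hBasis H₂ p.2), u⟫))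
        ⟪tp y v, (∑' p, InnerProductSpace.rankOne ℂ (w p) (w p)) (tp x u)⟫ := by
      refine HasSum.congr_fun (f := fun p => ⟪tp y v, InnerProductSpace.rankOne ℂ (w p) (w p) (tp x u)⟫) a1 fun p => ?_
      simp only [InnerProductSpace.rankOne_apply, inner_smul_right, hw, htp.inner_tp]
      ring
    have a3 := aux_sqrt_hasSum (hBasis H₁) hS₁ h₁ x y
    have a4 := aux_sqrt_hasSum (hBasis H₂) hS₂ h₂ u v
    generalize (∑' p, InnerProductSpace.rankOne ℂ (w p) (w p)) = R at a2 ⊢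
    exact aux_mul_hasSum a3 a4 a2 (fun p => rfl)

lemma aux_nonempty {tp : H₁ → H₂ → H} (htp : IsHilbertTensor tp)
    {ρ₁ : H₁ →L[ℂ] H₁} (hρ₁pos : ρ₁.IsPositive) (hρ₁tr : opTrace ρ₁ = 1)
    {ρ₂ : H₂ →L[ℂ] H₂} (hρ₂pos : ρ₂.IsPositive) (hρ₂tr : opTrace ρ₂ = 1) :
    (couplings tp ρ₁ ρ₂).Nonempty := by
  obtain ⟨R, hR, h⟩ := aux_exists_prod htp hρ₁pos hρ₁tr hρ₂pos hρ₂tr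
  refine ⟨R, hR, ?_, ?_, ?_⟩
  · obtain ⟨S, -, hS⟩ := aux_exists_sqrt hR
    obtain ⟨S₁, hS₁, h₁⟩ := aux_exists_sqrt hρ₁pos
    obtain ⟨S₂, hS₂, h₂⟩ := aux_exists_sqrt hρ₂pos
    obtain ⟨b, hb⟩ := aux_exists_basis htp (hBasis H₁) (hBasis H₂)
    refine ne_top_of_le_ne_top ?_ (aux_traceNorm_pos_le b hS)
    have hsum := (aux_opTrace h₁ hρ₁tr).summable.mul_of_nonneg (aux_opTrace h₂ hρ₂tr).summable
      (fun _ => by positivity) (fun _ => by positivity)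
    have e : ∀ p, ‖S (b p)‖ₑ ^ 2 =
        ENNReal.ofReal (‖S₁ (hBasis H₁ p.1)‖ ^ 2 * ‖S₂ (hBasis H₂ p.2)‖ ^ 2) := by
      intro p
      have := h (hBasis H₁ p.1) (hBasis H₁ p.1) (hBasis H₂ p.2) (hBasis H₂ p.2)
      rw [← hb, aux_sqrt_self hS, aux_sqrt_self h₁, aux_sqrt_self h₂, ← Complex.ofReal_mul] at this
      rw [← Complex.ofReal_injective this, ENNReal.ofReal_pow (norm_nonneg _), ofReal_norm]
    simp_rw [e]
    rw [← ENNReal.ofReal_tsum_of_nonneg (fun _ => by positivity) hsum]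
    exact ENNReal.ofReal_ne_top
  · intro x y
    simp_rw [h]
    rw [tsum_mul_left]
    change _ = _ * opTrace ρ₂
    rw [hρ₂tr, mul_one]
  · intro x y
    simp_rw [h]
    rw [tsum_mul_right]
    change _ = opTrace ρ₁ * _
    rw [hρ₁tr, one_mul]

lemma aux_convex {tp : H₁ → H₂ → H} (htp : IsHilbertTensor tp)
    {ρ₁ : H₁ →L[ℂ] H₁} {ρ₂ : H₂ →L[ℂ] H₂} {ρ σ : H →L[ℂ] H} (hρ : ρ ∈ couplings tp ρ₁ ρ₂)
    (hσ : σ ∈ couplings tp ρ₁ ρ₂) {t : ℝ} (h0 : 0 ≤ t) (h1 : t ≤ 1) :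
    t • ρ + (1 - t) • σ ∈ couplings tp ρ₁ ρ₂ := by
  have e : t • ρ + (1 - t) • σ = (t : ℂ) • ρ + (1 - (t : ℂ)) • σ := by
    rw [← Complex.coe_smul, ← Complex.coe_smul]; simp
  obtain ⟨p1, p2, p3, p4⟩ := hρ
  obtain ⟨q1, q2, q3, q4⟩ := hσ
  rw [e]
  refine ⟨?_, ?_, aux_pt_combo htp p2 q2 p3 q3 t, aux_pt_combo (aux_swap htp) p2 q2 p4 q4 t⟩
  · refine (p1.smul_of_nonneg ?_).add (q1.smul_of_nonneg ?_)
    · exact_mod_cast h0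
    · have : (1 - (t : ℂ)) = ((1 - t : ℝ) : ℂ) := by simp
      rw [this]
      exact_mod_cast sub_nonneg.2 h1
  · refine ne_top_of_le_ne_top ?_ (aux_traceNorm_add _ _)
    exact ENNReal.add_ne_top.2
      ⟨ne_top_of_le_ne_top (ENNReal.mul_ne_top enorm_ne_top p2) (aux_traceNorm_smul_le _ _),
       ne_top_of_le_ne_top (ENNReal.mul_ne_top enorm_ne_top q2) (aux_traceNorm_smul_le _ _)⟩

lemma aux_countable [TopologicalSpace.SeparableSpace H] {ι : Type*} {b : ι → H}
    (hb : Orthonormal ℂ b) : Countable ι := by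
  refine Pairwise.countable_of_isOpen_disjoint (s := fun i => Metric.ball (b i) (1 / 2)) ?_
    (fun i => Metric.isOpen_ball) (fun i => ⟨b i, Metric.mem_ball_self (by norm_num)⟩)
  intro i j hij
  apply Metric.ball_disjoint_ball
  rw [dist_eq_norm]
  have h := norm_sub_sq (𝕜 := ℂ) (b i) (b j)
  rw [hb.2 hij, hb.1, hb.1] at h
  norm_num at h
  nlinarith [norm_nonneg (b i - b j)]

lemma aux_tail_choice {ι : Type*} [DecidableEq ι] {r : ι → ENNReal} (hr : ∑' i, r i ≠ ⊤) {δ : ENNReal}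
    (hδ : 0 < δ) : ∃ A : Finset ι, ∑' i, (if i ∈ A then 0 else r i) ≤ δ := by
  have h := ENNReal.tendsto_tsum_compl_atTop_zero hr
  obtain ⟨A, hA⟩ := (h.eventually (ge_mem_nhds hδ)).exists
  refine ⟨A, le_trans (le_of_eq ?_) hA⟩
  have := tsum_subtype {x | x ∉ A} r
  refine Eq.trans ?_ this.symm
  refine tsum_congr fun i => ?_
  by_cases hi : i ∈ A <;> simp [hi]

lemma aux_total {tp : H₁ → H₂ → H} (htp : IsHilbertTensor tp)
    {ρ₁ : H₁ →L[ℂ] H₁} (hρ₁pos : ρ₁.IsPositive) (hρ₁tr : opTrace ρ₁ = 1)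
    {ρ₂ : H₂ →L[ℂ] H₂} {γ S : H →L[ℂ] H} (hγ : γ ∈ couplings tp ρ₁ ρ₂)
    (h : ∀ x y, ⟪S x, S y⟫ = ⟪x, γ y⟫) :
    ∑' p : hIndex H₁ × hIndex H₂, ‖S (tp (hBasis H₁ p.1) (hBasis H₂ p.2))‖ₑ ^ 2 = 1 := by
  rw [ENNReal.tsum_prod (f := fun i j => ‖S (tp (hBasis H₁ i) (hBasis H₂ j))‖ₑ ^ 2)]
  simp_rw [aux_marginal htp hγ.2.1 h hγ.2.2.1]
  exact aux_opTrace_enn hρ₁pos hρ₁tr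

open Classical in
lemma aux_tight {tp : H₁ → H₂ → H} (htp : IsHilbertTensor tp)
    {ρ₁ : H₁ →L[ℂ] H₁} (hρ₁pos : ρ₁.IsPositive) (hρ₁tr : opTrace ρ₁ = 1)
    {ρ₂ : H₂ →L[ℂ] H₂} (hρ₂pos : ρ₂.IsPositive) (hρ₂tr : opTrace ρ₂ = 1)
    {δ : ENNReal} (hδ : 0 < δ) :
    ∃ F : Finset (hIndex H₁ × hIndex H₂), ∀ γ ∈ couplings tp ρ₁ ρ₂, ∀ S : H →L[ℂ] H,
      (∀ x y, ⟪S x, S y⟫ = ⟪x, γ y⟫) →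
      ∑' p : hIndex H₁ × hIndex H₂,
        (if p ∈ F then 0 else ‖S (tp (hBasis H₁ p.1) (hBasis H₂ p.2))‖ₑ ^ 2) ≤ δ := by
  have hδ2 : 0 < δ / 2 := ENNReal.half_pos hδ.ne'
  obtain ⟨A, hA⟩ := aux_tail_choice
    (r := fun i => ENNReal.ofReal (⟪(hBasis H₁ i : H₁), ρ₁ (hBasis H₁ i)⟫ : ℂ).re)
    (by rw [aux_opTrace_enn hρ₁pos hρ₁tr]; simp) hδ2
  obtain ⟨B, hB⟩ := aux_tail_choice
    (r := fun i => ENNReal.ofReal (⟪(hBasis H₂ i : H₂), ρ₂ (hBasis H₂ i)⟫ : ℂ).re)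
    (by rw [aux_opTrace_enn hρ₂pos hρ₂tr]; simp) hδ2
  refine ⟨A ×ˢ B, fun γ hγ S h => ?_⟩
  set d : hIndex H₁ → hIndex H₂ → ENNReal := fun i j => ‖S (tp (hBasis H₁ i) (hBasis H₂ j))‖ₑ ^ 2
    with hd
  have m1 : ∀ i, ∑' j, d i j = _ := fun i => aux_marginal htp hγ.2.1 h hγ.2.2.1 (hBasis H₁ i)
  have m2 : ∀ j, ∑' i, d i j = _ := fun j =>
    aux_marginal (aux_swap htp) hγ.2.1 h hγ.2.2.2 (hBasis H₂ j)
  calc ∑' p : hIndex H₁ × hIndex H₂, (if p ∈ A ×ˢ B then 0 else d p.1 p.2)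
      ≤ ∑' p : hIndex H₁ × hIndex H₂,
        ((if p.1 ∈ A then 0 else d p.1 p.2) + (if p.2 ∈ B then 0 else d p.1 p.2)) := by
        refine ENNReal.tsum_le_tsum fun p => ?_
        by_cases h1 : p.1 ∈ A <;> by_cases h2 : p.2 ∈ B <;> simp [Finset.mem_product, h1, h2]
    _ = ∑' i, ∑' j, (if i ∈ A then 0 else d i j) + ∑' j, ∑' i, (if j ∈ B then 0 else d i j) := by
        rw [ENNReal.tsum_add, ENNReal.tsum_prod (f := fun i j => if i ∈ A then 0 else d i j),
          ENNReal.tsum_prod (f := fun i j => if j ∈ B then 0 else d i j)]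
        congr 1
        exact ENNReal.tsum_comm
    _ = ∑' i, (if i ∈ A then 0 else ∑' j, d i j) + ∑' j, (if j ∈ B then 0 else ∑' i, d i j) := by
        congr 1
        · refine tsum_congr fun i => ?_
          split_ifs <;> simp
        · refine tsum_congr fun i => ?_
          split_ifs <;> simp
    _ ≤ δ / 2 + δ / 2 := by
        simp_rw [m1, m2]
        exact add_le_add hA hB
    _ = δ := ENNReal.add_halves δ

lemma aux_compact [TopologicalSpace.SeparableSpace H] {tp : H₁ → H₂ → H} (htp : IsHilbertTensor tp)
    {ρ₁ : H₁ →L[ℂ] H₁} (hρ₁pos : ρ₁.IsPositive) (hρ₁tr : opTrace ρ₁ = 1)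
    {ρ₂ : H₂ →L[ℂ] H₂} (hρ₂pos : ρ₂.IsPositive) (hρ₂tr : opTrace ρ₂ = 1)
    (γ : ℕ → H →L[ℂ] H) (hγ : ∀ m, γ m ∈ couplings tp ρ₁ ρ₂) :
    ∃ φ : ℕ → ℕ, StrictMono φ ∧ ∃ g ∈ couplings tp ρ₁ ρ₂,
        Tendsto (fun k => traceNorm (γ (φ k) - g)) atTop (𝓝 0) := by
  classical
  obtain ⟨b, hb⟩ := aux_exists_basis htp (hBasis H₁) (hBasis H₂)
  choose S _ hS using fun m => aux_exists_sqrt (hγ m).1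
  have hcount : Countable (hIndex H₁ × hIndex H₂) := aux_countable b.orthonormal
  have htot : ∀ m, ∑' i, ‖S m (b i)‖ₑ ^ 2 ≤ 1 := fun m => by
    simp_rw [hb]
    exact (aux_total htp hρ₁pos hρ₁tr (hγ m) (hS m)).le
  have hnorm : ∀ m, ‖γ m‖ ≤ 1 := fun m => aux_opNorm_le _ zero_le_one <| by
    simpa using (aux_traceNorm_pos_le b (hS m)).trans (htot m)
  set a : ℕ → ((hIndex H₁ × hIndex H₂) × (hIndex H₁ × hIndex H₂) → ℂ) := fun m p => ⟪γ m (b p.1), b p.2⟫ with ha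
  have hK : IsCompact (Set.univ.pi fun _ : (hIndex H₁ × hIndex H₂) × (hIndex H₁ × hIndex H₂) => Metric.closedBall (0 : ℂ) 1) :=
    isCompact_univ_pi fun _ => isCompact_closedBall _ _
  have haK : ∀ m, a m ∈ Set.univ.pi fun _ : (hIndex H₁ × hIndex H₂) × (hIndex H₁ × hIndex H₂) => Metric.closedBall (0 : ℂ) 1 := by
    intro m p _
    rw [mem_closedBall_zero_iff]
    refine (norm_inner_le_norm _ _).trans ?_
    rw [b.orthonormal.1, mul_one]
    refine ((γ m).le_opNorm _).trans ?_
    rw [b.orthonormal.1, mul_one]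
    exact hnorm m
  obtain ⟨al, -, φ, hφ, hlim⟩ := hK.tendsto_subseq haK
  have hlim' : ∀ p q, Tendsto (fun k => ⟪γ (φ k) (b p), b q⟫) atTop (𝓝 (al (p, q))) :=
    fun p q => (tendsto_pi_nhds.1 hlim) (p, q)
  have hcau : ∀ ε : ENNReal, 0 < ε → ε ≠ ⊤ →
      ∃ N, ∀ k ≥ N, ∀ l ≥ N, traceNorm (γ (φ k) - γ (φ l)) ≤ ε := by
    intro ε hε hεt
    have hε8 : 0 < ε / 8 := ENNReal.div_pos hε.ne' (by norm_num)
    obtain ⟨F, hF⟩ := aux_tight htp hρ₁pos hρ₁tr hρ₂pos hρ₂tr (δ := (ε / 8) ^ 2)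
      (ENNReal.pow_pos hε8 2)
    have t1 : Tendsto (fun kl : ℕ × ℕ => ∑ p ∈ F, ∑ q ∈ F,
        ‖⟪(γ (φ kl.1) - γ (φ kl.2)) (b p), b q⟫‖ₑ) (atTop ×ˢ atTop) (𝓝 0) := by
      have : (0 : ENNReal) = ∑ p ∈ F, ∑ q ∈ F, ‖al (p, q) - al (p, q)‖ₑ := by simp
      rw [this]
      refine tendsto_finsetSum _ fun p _ => tendsto_finsetSum _ fun q _ => ?_
      simp only [_root_.sub_apply, inner_sub_left]
      exact (((hlim' p q).comp tendsto_fst).sub ((hlim' p q).comp tendsto_snd)).enorm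
    rw [prod_atTop_atTop_eq] at t1
    have t2 := t1.eventually (ge_mem_nhds (ENNReal.half_pos hε.ne'))
    obtain ⟨⟨N1, N2⟩, hN⟩ := eventually_atTop.1 t2
    refine ⟨max N1 N2, fun k hk l hl => ?_⟩
    have t3 := hN (k, l) ⟨(le_max_left _ _).trans hk, (le_max_right _ _).trans hl⟩
    have hF' : ∀ m, ∑' i, (if i ∈ F then 0 else ‖S m (b i)‖ₑ ^ 2) ≤ (ε / 8) ^ 2 := fun m => by
      simp_rw [hb]
      exact hF _ (hγ m) _ (hS m)
    have t4 := aux_traceNorm_sub_le b F (hS (φ k)) (hS (φ l)) (htot _) (htot _) (hF' _) (hF' _)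
    refine t4.trans ?_
    refine (add_le_add le_rfl t3).trans ?_
    have t5 : ((ε / 8) ^ 2) ^ (1 / 2 : ℝ) = ε / 8 := by
      rw [← ENNReal.rpow_natCast, ← ENNReal.rpow_mul]; norm_num
    rw [t5]
    lift ε to NNReal using hεt
    apply le_of_eq
    have : (ε : ENNReal) / 8 = ((ε / 8 : NNReal) : ENNReal) := by
      rw [ENNReal.coe_div (by norm_num)]; simp
    rw [this]
    have : (ε : ENNReal) / 2 = ((ε / 2 : NNReal) : ENNReal) := by
      rw [ENNReal.coe_div (by norm_num)]; simp
    rw [this]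
    norm_cast
    apply NNReal.eq
    push_cast
    ring
  have hcs : CauchySeq fun k => γ (φ k) := by
    rw [Metric.cauchySeq_iff]
    intro ε hε
    obtain ⟨N, hN⟩ := hcau (ENNReal.ofReal (ε / 2)) (by simpa using hε) ENNReal.ofReal_ne_top
    refine ⟨N, fun k hk l hl => ?_⟩
    rw [dist_eq_norm]
    exact (aux_opNorm_le _ (by positivity) (hN k hk l hl)).trans_lt (by linarith)
  obtain ⟨g, hg⟩ := cauchySeq_tendsto_of_complete hcs
  have hle : ∀ ε : ENNReal, 0 < ε → ε ≠ ⊤ → ∃ N, ∀ k ≥ N, traceNorm (γ (φ k) - g) ≤ ε := by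
    intro ε hε hεt
    obtain ⟨N, hN⟩ := hcau ε hε hεt
    refine ⟨N, fun k hk => aux_traceNorm_le fun n x y hx hy => ?_⟩
    have u1 : Tendsto (fun l => ∑ i, ‖⟪(γ (φ k) - γ (φ l)) (x i), y i⟫‖ₑ) atTop
        (𝓝 (∑ i, ‖⟪(γ (φ k) - g) (x i), y i⟫‖ₑ)) := by
      refine tendsto_finsetSum _ fun i _ => ?_
      have v : Tendsto (fun l => (γ (φ k) - γ (φ l)) (x i)) atTop (𝓝 ((γ (φ k) - g) (x i))) :=
        ((ContinuousLinearMap.apply ℂ H (x i)).continuous.tendsto _).comp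
          (tendsto_const_nhds.sub hg)
      exact (v.inner tendsto_const_nhds).enorm
    refine le_of_tendsto u1 (eventually_atTop.2 ⟨N, fun l hl => ?_⟩)
    exact (aux_le_traceNorm _ hx hy).trans (hN k hk l hl)
  have htend : Tendsto (fun k => traceNorm (γ (φ k) - g)) atTop (𝓝 0) := by
    rw [ENNReal.tendsto_atTop_zero]
    intro ε hε
    obtain ⟨N, hN⟩ := hle (min ε 1) (lt_min hε one_pos)
      (ne_top_of_le_ne_top ENNReal.one_ne_top (min_le_right _ _))
    exact ⟨N, fun k hk => (hN k hk).trans (min_le_left _ _)⟩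
  have hgt : traceNorm g ≠ ⊤ := by
    obtain ⟨N, hN⟩ := hle 1 one_pos ENNReal.one_ne_top
    have e : g = γ (φ N) + (g - γ (φ N)) := by abel
    rw [e]
    refine ne_top_of_le_ne_top ?_ (aux_traceNorm_add _ _)
    refine ENNReal.add_ne_top.2 ⟨(hγ _).2.1, ?_⟩
    exact ne_top_of_le_ne_top ENNReal.one_ne_top ((aux_traceNorm_sub_comm _ _).trans (hN N le_rfl))
  refine ⟨φ, hφ, g, ⟨aux_isPositive_of_tendsto hg fun k => (hγ _).1, hgt, ?_, ?_⟩, htend⟩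
  · exact aux_pt_limit htp (fun k => (hγ (φ k)).2.1) (fun k => (hγ (φ k)).2.2.1) hgt htend
  · exact aux_pt_limit (aux_swap htp) (fun k => (hγ (φ k)).2.1) (fun k => (hγ (φ k)).2.2.2) hgt htend

end Aux4

variable {H₁ H₂ H : Type*}
  [NormedAddCommGroup H₁] [InnerProductSpace ℂ H₁] [CompleteSpace H₁]
  [TopologicalSpace.SeparableSpace H₁]
  [NormedAddCommGroup H₂] [InnerProductSpace ℂ H₂] [CompleteSpace H₂]
  [TopologicalSpace.SeparableSpace H₂]
  [NormedAddCommGroup H] [InnerProductSpace ℂ H] [CompleteSpace H]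
  [TopologicalSpace.SeparableSpace H]

/-- for density operators `ρ₁`, `ρ₂`, the set `M(ρ₁,ρ₂)` of couplings is
nonempty, convex, and compact in the trace norm topology (every sequence in it has a
subsequence converging in trace norm to an element of it). -/
theorem couplings_nonempty_convex_compact
    (tp : H₁ → H₂ → H) (htp : IsHilbertTensor tp)
    (ρ₁ : H₁ →L[ℂ] H₁) (hρ₁pos : ρ₁.IsPositive) (hρ₁tc : traceNorm ρ₁ ≠ ⊤)
    (hρ₁tr : opTrace ρ₁ = 1)
    (ρ₂ : H₂ →L[ℂ] H₂) (hρ₂pos : ρ₂.IsPositive) (hρ₂tc : traceNorm ρ₂ ≠ ⊤)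
    (hρ₂tr : opTrace ρ₂ = 1) :
    (couplings tp ρ₁ ρ₂).Nonempty ∧
    (∀ ρ ∈ couplings tp ρ₁ ρ₂, ∀ σ ∈ couplings tp ρ₁ ρ₂, ∀ t : ℝ, 0 ≤ t → t ≤ 1 →
      t • ρ + (1 - t) • σ ∈ couplings tp ρ₁ ρ₂) ∧
    (∀ γ : ℕ → H →L[ℂ] H, (∀ m, γ m ∈ couplings tp ρ₁ ρ₂) →
      ∃ φ : ℕ → ℕ, StrictMono φ ∧ ∃ g ∈ couplings tp ρ₁ ρ₂,
        Tendsto (fun k => traceNorm (γ (φ k) - g)) atTop (𝓝 0)) := by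
  exact ⟨aux_nonempty htp hρ₁pos hρ₁tr hρ₂pos hρ₂tr,
    fun ρ hρ σ hσ t h0 h1 => aux_convex htp hρ hσ h0 h1,
    fun γ hγ => aux_compact htp hρ₁pos hρ₁tr hρ₂pos hρ₂tr γ hγ⟩
end
end
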